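/- Let a ≥ 2 be an integer and let h, u be odd integers with u ≠ −1, h ≠ −1, ν₂(u−1) = 1 and ν₂(h−1) = 1. Let h̄ denote the image of h in the quotient group (Z/2^a Z)^*/⟨ū⟩ and write the order of h̄ as 2^v. Then: if ν₂(h+1) = ν₂(u+1), then v = 0; and if ν₂(h+1) ≠ ν₂(u+1), then v = max{ min{ν₂(u+1)+1, a} − min{ν₂(h+1), ν₂(u+1)}, 0 }. -/

import Mathlib

lemma exists_odd_pow_two_pow_eq {m : ℕ} (hm : 2 ≤ m) {c : ℤ} (hc : Odd c) (n : ℕ) :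
    ∃ d : ℤ, Odd d ∧ (1 + 2 ^ m * c) ^ 2 ^ n = 1 + 2 ^ (m + n) * d := by
  induction n with
  | zero => exact ⟨c, hc, by simp⟩
  | succ n ih =>
    obtain ⟨d, hd, h⟩ := ih
    obtain ⟨k, rfl⟩ : ∃ k, m = k + 2 := ⟨m - 2, by omega⟩
    refine ⟨d + 2 * (2 ^ (k + n) * d ^ 2), hd.add_even (even_two_mul _), ?_⟩
    rw [pow_succ 2 n, pow_mul, h]
    ring

lemma exists_two_pow_dvd_sub_pow {m : ℕ} (hm : 2 ≤ m) {c x : ℤ} (hc : Odd c)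
    (hx : 2 ^ m ∣ x - 1) (n : ℕ) : ∃ k : ℕ, 2 ^ (m + n) ∣ x - (1 + 2 ^ m * c) ^ k := by
  induction n with
  | zero => exact ⟨0, by simpa using hx⟩
  | succ n ih =>
    obtain ⟨k, e, he⟩ := ih
    rcases Int.even_or_odd e with ⟨f, rfl⟩ | ho
    · exact ⟨k, f, by rw [he]; ring⟩
    · obtain ⟨d, hd, h⟩ := exists_odd_pow_two_pow_eq hm hc n
      have hy : Odd ((1 + 2 ^ m * c) ^ k) := by
        refine Odd.pow (odd_one.add_even (Even.mul_right ?_ c))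
        exact (even_two (α := ℤ)).pow_of_ne_zero (by omega)
      obtain ⟨f, hf⟩ := ho.sub_odd (hy.mul hd)
      refine ⟨k + 2 ^ n, f, ?_⟩
      rw [pow_add, h]
      linear_combination he + 2 ^ (m + n) * hf

/-- For `u = 2 ^ t * w - 1` with `w` odd and `2 ≤ t`, the residues `1` modulo `4` in the subgroup
generated by `u` are those congruent to `1` modulo `2 ^ (t + 1)`. -/
lemma mem_zpowers_iff_two_pow_dvd_sub_one {a : ℕ} (ha : 2 ≤ a) {t : ℕ} (ht : 2 ≤ t) {u w x : ℤ}
    (hw : Odd w) (hu : u + 1 = 2 ^ t * w) (hx : 4 ∣ x - 1) {ubar xbar : (ZMod (2 ^ a))ˣ}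
    (hub : (ubar : ZMod (2 ^ a)) = (u : ZMod (2 ^ a)))
    (hxb : (xbar : ZMod (2 ^ a)) = (x : ZMod (2 ^ a))) :
    xbar ∈ Subgroup.zpowers ubar ↔ 2 ^ min (t + 1) a ∣ x - 1 := by
  have hpow (k : ℕ) : ubar ^ k = xbar ↔ (2 : ℤ) ^ a ∣ x - u ^ k := by
    rw [Units.ext_iff, Units.val_pow_eq_pow_val, hub, hxb, ← Int.cast_pow,
      ZMod.intCast_eq_intCast_iff_dvd_sub]
    push_cast
    rfl
  obtain ⟨j, rfl⟩ : ∃ j, t = j + 2 := ⟨t - 2, by omega⟩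
  obtain rfl : u = 2 ^ (j + 2) * w - 1 := by linarith
  have hsq : (2 ^ (j + 2) * w - 1) ^ 2 =
      1 + 2 ^ (j + 2 + 1) * (w * (2 * (2 ^ j * w) - 1)) := by ring
  rw [← mem_powers_iff_mem_zpowers]
  constructor
  · rintro ⟨k, hk⟩
    have hk := (hpow k).1 hk
    rcases Nat.even_or_odd' k with ⟨l, rfl | rfl⟩
    · have h1 : (2 : ℤ) ^ min (j + 2 + 1) a ∣ (2 ^ (j + 2) * w - 1) ^ (2 * l) - 1 := by
        rw [pow_mul]
        refine ((pow_dvd_pow 2 (min_le_left _ _)).trans ?_).trans (sub_one_dvd_pow_sub_one _ l)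
        rw [hsq]
        exact ⟨w * (2 * (2 ^ j * w) - 1), by ring⟩
      have := ((pow_dvd_pow 2 (min_le_right _ _)).trans hk).add h1
      simpa using this
    · exfalso
      have h4 : (4 : ℤ) ∣ x - (2 ^ (j + 2) * w - 1) ^ (2 * l + 1) :=
        Dvd.dvd.trans (by simpa using pow_dvd_pow (2 : ℤ) ha) hk
      have h5 : (4 : ℤ) ∣ (2 ^ (j + 2) * w - 1) ^ (2 * l + 1) + 1 := by
        have h6 := Odd.add_dvd_pow_add_pow (2 ^ (j + 2) * w - 1) 1 (odd_two_mul_add_one l)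
        rw [one_pow] at h6
        exact Dvd.dvd.trans ⟨2 ^ j * w, by ring⟩ h6
      omega
  · intro h
    rcases le_total a (j + 2 + 1) with hle | hle
    · rw [min_eq_right hle] at h
      exact ⟨0, (hpow 0).2 (by simpa using h)⟩
    · rw [min_eq_left hle] at h
      obtain ⟨k, hk⟩ := exists_two_pow_dvd_sub_pow (by omega)
        (hw.mul ((even_two_mul _).sub_odd odd_one)) h (a - (j + 2 + 1))
      rw [Nat.add_sub_cancel' hle, ← hsq, ← pow_mul] at hk
      exact ⟨2 * k, (hpow _).2 hk⟩

lemma exists_odd_eq_two_pow_padicValInt_mul {n : ℤ} (hn : n ≠ 0) :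
    ∃ w : ℤ, Odd w ∧ n = 2 ^ padicValInt 2 n * w := by
  obtain ⟨w, hw⟩ := padicValInt_dvd (p := 2) n
  push_cast at hw
  refine ⟨w, ?_, hw⟩
  by_contra hodd
  obtain ⟨f, rfl⟩ := Int.not_odd_iff_even.1 hodd
  have hdvd : ((2 : ℕ) : ℤ) ^ (padicValInt 2 n + 1) ∣ n :=
    ⟨f, by push_cast; rw [pow_succ]; linear_combination hw⟩
  rw [padicValInt_dvd_iff] at hdvd
  omega

lemma two_le_padicValInt_add_one {n : ℤ} (hn : n ≠ -1) (h : padicValInt 2 (n - 1) = 1) :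
    2 ≤ padicValInt 2 (n + 1) := by
  have h0 : n - 1 ≠ 0 := by
    intro h0
    simp [h0] at h
  obtain ⟨w, ⟨k, rfl⟩, hw⟩ := exists_odd_eq_two_pow_padicValInt_mul h0
  rw [h] at hw
  have hdvd : ((2 : ℕ) : ℤ) ^ 2 ∣ n + 1 := ⟨k + 1, by push_cast; linear_combination hw⟩
  rw [padicValInt_dvd_iff] at hdvd
  exact hdvd.resolve_left (by omega)

lemma two_pow_dvd_two_pow_mul_odd_iff {M m : ℕ} {d : ℤ} (hd : Odd d) :
    (2 : ℤ) ^ M ∣ 2 ^ m * d ↔ M ≤ m := by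
  refine ⟨fun h ↦ ?_, fun h ↦ (pow_dvd_pow 2 h).mul_right d⟩
  by_contra! hlt
  have h1 : (2 : ℤ) ^ m * 2 ∣ 2 ^ m * d := by
    rw [← pow_succ]
    exact (pow_dvd_pow 2 hlt).trans h
  have h2 := (mul_dvd_mul_iff_left (by positivity)).1 h1
  exact Int.not_even_iff_odd.2 hd (even_iff_two_dvd.2 h2)

lemma exists_odd_mul_sub_one_eq {s t : ℕ} (hst : s ≠ t) {h u v w : ℤ} (hv : Odd v) (hw : Odd w)
    (hh : h + 1 = 2 ^ s * v) (hu : u + 1 = 2 ^ t * w) (hodd : Odd h) :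
    ∃ d : ℤ, Odd d ∧ h * u - 1 = 2 ^ min s t * d := by
  rcases lt_or_gt_of_ne hst with hlt | hlt
  · obtain ⟨k, rfl⟩ := Nat.exists_eq_add_of_lt hlt
    rw [min_eq_left hlt.le]
    refine ⟨2 * (2 ^ k * (h * w)) - v, (even_two_mul _).sub_odd hv, ?_⟩
    linear_combination h * hu - hh
  · obtain ⟨k, rfl⟩ := Nat.exists_eq_add_of_lt hlt
    rw [min_eq_right hlt.le]
    refine ⟨h * w - 2 * (2 ^ k * v), (hodd.mul hw).sub_even (even_two_mul _), ?_⟩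
    linear_combination h * hu - hh

/-- Let `a ≥ 2` and let `h`, `u` be odd integers with `u ≠ -1`,
`h ≠ -1`, `ν₂(u-1) = 1` and `ν₂(h-1) = 1`.  Let `hbar`, `ubar` be the residues
of `h`, `u` in `(ZMod (2^a))ˣ`, and write the order of the image of `hbar` in
`(ZMod (2^a))ˣ / ⟨ubar⟩` as `2 ^ v`.  Then `v = 0` if `ν₂(h+1) = ν₂(u+1)`, and
`v = max (min (ν₂(u+1)+1) a - min (ν₂(h+1)) (ν₂(u+1))) 0` otherwise. -/
theorem order_in_quotient_case_iv (a : ℕ) (ha : 2 ≤ a) (h u : ℤ)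
    (hh : Odd h) (hu : Odd u) (hune : u ≠ -1) (hhne : h ≠ -1)
    (hvu : padicValInt 2 (u - 1) = 1) (hvh : padicValInt 2 (h - 1) = 1)
    (ubar hbar : (ZMod (2 ^ a))ˣ)
    (hub : (ubar : ZMod (2 ^ a)) = (u : ZMod (2 ^ a)))
    (hhb : (hbar : ZMod (2 ^ a)) = (h : ZMod (2 ^ a))) :
    (padicValInt 2 (h + 1) = padicValInt 2 (u + 1) →
      orderOf (QuotientGroup.mk hbar : (ZMod (2 ^ a))ˣ ⧸ Subgroup.zpowers ubar) =
        2 ^ (0 : ℕ)) ∧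
    (padicValInt 2 (h + 1) ≠ padicValInt 2 (u + 1) →
      orderOf (QuotientGroup.mk hbar : (ZMod (2 ^ a))ˣ ⧸ Subgroup.zpowers ubar) =
        2 ^ max (min (padicValInt 2 (u + 1) + 1) a -
          min (padicValInt 2 (h + 1)) (padicValInt 2 (u + 1))) 0) := by
  have hs := two_le_padicValInt_add_one hhne hvh
  have ht := two_le_padicValInt_add_one hune hvu
  obtain ⟨v, hv, hhv⟩ := exists_odd_eq_two_pow_padicValInt_mul (n := h + 1) (by omega)
  obtain ⟨w, hw, huw⟩ := exists_odd_eq_two_pow_padicValInt_mul (n := u + 1) (by omega)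
  generalize padicValInt 2 (h + 1) = s at *
  generalize padicValInt 2 (u + 1) = t at *
  have h4h : (4 : ℤ) ∣ h + 1 := by
    rw [hhv]
    exact (Dvd.dvd.mul_right (by simpa using pow_dvd_pow (2 : ℤ) hs) v)
  have h4u : (4 : ℤ) ∣ u + 1 := by
    rw [huw]
    exact (Dvd.dvd.mul_right (by simpa using pow_dvd_pow (2 : ℤ) ht) w)
  have hbase : (QuotientGroup.mk hbar : (ZMod (2 ^ a))ˣ ⧸ Subgroup.zpowers ubar) = 1 ↔
      2 ^ min (t + 1) a ∣ h * u - 1 := by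
    rw [QuotientGroup.eq_one_iff,
      ← Subgroup.mul_mem_cancel_right _ (Subgroup.mem_zpowers ubar)]
    refine mem_zpowers_iff_two_pow_dvd_sub_one ha ht hw huw ?_ hub
      (by rw [Units.val_mul, hhb, hub, Int.cast_mul])
    rw [show h * u - 1 = h * (u + 1) - (h + 1) by ring]
    exact (h4u.mul_left h).sub h4h
  have hpow (n : ℕ) :
      (QuotientGroup.mk hbar : (ZMod (2 ^ a))ˣ ⧸ Subgroup.zpowers ubar) ^ 2 ^ (n + 1) = 1 ↔
        min (t + 1) a ≤ s + (n + 1) := by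
    obtain ⟨j, rfl⟩ : ∃ j, s = j + 2 := ⟨s - 2, by omega⟩
    have hodd : Odd (v * (2 * (2 ^ j * v) - 1)) := hv.mul ((even_two_mul _).sub_odd odd_one)
    have hsq : h ^ 2 = 1 + 2 ^ (j + 2 + 1) * (v * (2 * (2 ^ j * v) - 1)) := by
      rw [eq_sub_of_add_eq hhv]
      ring
    obtain ⟨d, hd, he⟩ := exists_odd_pow_two_pow_eq (m := j + 2 + 1) (by omega) hodd n
    have he' : h ^ 2 ^ (n + 1) - 1 = 2 ^ (j + 2 + (n + 1)) * d := by
      rw [pow_succ', pow_mul, hsq, he]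
      ring
    rw [← QuotientGroup.mk_pow, QuotientGroup.eq_one_iff,
      mem_zpowers_iff_two_pow_dvd_sub_one (x := h ^ 2 ^ (n + 1)) ha ht hw huw
        (by rw [he']; exact ⟨2 ^ (j + (n + 1)) * d, by ring⟩) hub
        (by rw [Units.val_pow_eq_pow_val, hhb, Int.cast_pow]),
      he', two_pow_dvd_two_pow_mul_odd_iff hd]
  constructor
  · rintro rfl
    rw [pow_zero, orderOf_eq_one_iff, hbase]
    refine (pow_dvd_pow 2 (min_le_left _ _)).trans ?_
    obtain ⟨e, he⟩ := (hh.mul hw).sub_odd hv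
    exact ⟨e, by linear_combination h * huw - hhv + 2 ^ s * he⟩
  · intro hst
    obtain ⟨d, hd, he⟩ := exists_odd_mul_sub_one_eq hst hv hw hhv huw hh
    rw [he, two_pow_dvd_two_pow_mul_odd_iff hd] at hbase
    rw [max_eq_left (Nat.zero_le _)]
    rcases hn : min (t + 1) a - min s t with _ | n
    · rw [pow_zero, orderOf_eq_one_iff, hbase]
      omega
    · refine orderOf_eq_prime_pow ?_ ((hpow n).2 (by omega))
      rcases n with _ | n
      · rw [pow_zero, pow_one, hbase]
        omega
      · rw [hpow]
        omega
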